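/- Let p ≥ 5 be a prime number, let K be a field of characteristic p, let b ≥ 1 and e ≥ 2 be integers, and set q = p^e and d = 2·b·p^(e−1) + 1. Let R = K[X,Y,Z]/(X^d + Y^d + Z^d) with x, y, z the images of the variables. Then z^(b·q + p) does not belong to the ideal of R generated by x^(bq) and y^(bq). -/

import Mathlib

open MvPolynomial

/-- The coefficient of `X ^ (d * u) * Y ^ d` in `(X ^ d + Y ^ d) ^ (u + 1)` is `u + 1`. -/
theorem coeff_X_pow_add_X_pow_pow {R : Type*} [CommRing R] {d : ℕ} (hd : d ≠ 0) (u : ℕ) :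
    coeff (Finsupp.single 0 (d * u) + Finsupp.single 1 d)
      ((X 0 ^ d + X 1 ^ d : MvPolynomial (Fin 2) R) ^ (u + 1)) = (u + 1 : ℕ) := by
  have hterm (m : ℕ) : ((X 0 : MvPolynomial (Fin 2) R) ^ d) ^ m * (X 1 ^ d) ^ (u + 1 - m) *
      ((u + 1).choose m : MvPolynomial (Fin 2) R) =
      monomial (Finsupp.single (0 : Fin 2) (d * m) + Finsupp.single 1 (d * (u + 1 - m)))
        ((u + 1).choose m : R) := by
    rw [← pow_mul, ← pow_mul, X_pow_eq_monomial, X_pow_eq_monomial, monomial_mul,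
      ← map_natCast (C : R →+* MvPolynomial (Fin 2) R), mul_comm, C_mul_monomial]
    simp
  rw [add_pow, coeff_sum, Finset.sum_eq_single u]
  · rw [hterm]
    simp
  · intro m _ hm
    rw [hterm, coeff_monomial, if_neg]
    intro h
    have h0 := DFunLike.congr_fun h 0
    simp at h0
    tauto
  · intro h
    simp at h

/-- A polynomial with a nonzero coefficient at a monomial whose exponents are both less than `n`
does not lie in the ideal `(X ^ n, Y ^ n)`. -/
theorem notMem_span_X_pow_of_coeff_ne_zero {R : Type*} [CommRing R] {n : ℕ}
    {f : MvPolynomial (Fin 2) R} {m : Fin 2 →₀ ℕ} (hm : ∀ i, m i < n) (hf : coeff m f ≠ 0) :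
    f ∉ Ideal.span {(X 0 : MvPolynomial (Fin 2) R) ^ n, X 1 ^ n} := by
  intro h
  obtain ⟨a, b, rfl⟩ := Ideal.mem_span_pair.1 h
  apply hf
  have key (i : Fin 2) (g : MvPolynomial (Fin 2) R) : coeff m (g * X i ^ n) = 0 := by
    rw [X_pow_eq_monomial, coeff_mul_monomial', if_neg]
    intro hle
    have := hle i
    have := hm i
    simp at *
    omega
  rw [coeff_add, key, key, add_zero]

/-- The structure map into the ring obtained by adjoining a root of a monic polynomial of
positive degree is injective. -/
theorem AdjoinRoot.of_injective_of_monic {A : Type*} [CommRing A] {f : Polynomial A}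
    (hf : f.Monic) (hdeg : 0 < f.degree) : Function.Injective (AdjoinRoot.of f) := by
  rw [injective_iff_map_eq_zero]
  intro a ha
  rw [← AdjoinRoot.mk_C, AdjoinRoot.mk_eq_zero] at ha
  by_contra h
  exact hf.not_dvd_of_degree_lt (Polynomial.C_ne_zero.2 h)
    (Polynomial.degree_C_le.trans_lt hdeg) ha

/-- If `z ^ (d * u)` lies in the ideal `(x ^ n, y ^ n)` of `K[X, Y, Z] / (X ^ d + Y ^ d + Z ^ d)`,
then `(X ^ d + Y ^ d) ^ u` lies in the ideal `(X ^ n, Y ^ n)` of `K[X, Y]`. -/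
theorem X_pow_add_X_pow_pow_mem_of_mk_X_pow_mem {K : Type*} [Field K] {d n u : ℕ} (hd : d ≠ 0)
    (h : (Ideal.Quotient.mk (Ideal.span {(X 0 : MvPolynomial (Fin 3) K) ^ d + X 1 ^ d + X 2 ^ d})
        (X 2)) ^ (d * u) ∈
      Ideal.span {(Ideal.Quotient.mk _ (X 0)) ^ n, (Ideal.Quotient.mk _ (X 1)) ^ n}) :
    (X 0 ^ d + X 1 ^ d : MvPolynomial (Fin 2) K) ^ u ∈
      Ideal.span {(X 0 : MvPolynomial (Fin 2) K) ^ n, X 1 ^ n} := by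
  set J := Ideal.span {(X 0 : MvPolynomial (Fin 2) K) ^ n, X 1 ^ n} with hJ
  by_cases htop : J = ⊤
  · simp [htop]
  have : Nontrivial (MvPolynomial (Fin 2) K ⧸ J) := Ideal.Quotient.nontrivial_iff.2 htop
  set a : MvPolynomial (Fin 2) K ⧸ J := Ideal.Quotient.mk J (X 0 ^ d + X 1 ^ d) with ha
  set f : Polynomial (MvPolynomial (Fin 2) K ⧸ J) := Polynomial.X ^ d + Polynomial.C a with hf
  have hroot : AdjoinRoot.root f ^ d = -AdjoinRoot.of f a := by
    have := AdjoinRoot.eval₂_root f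
    simp only [hf, Polynomial.eval₂_add, Polynomial.eval₂_X_pow, Polynomial.eval₂_C] at this
    exact eq_neg_of_add_eq_zero_left this
  set ι := (AdjoinRoot.of f).comp (Ideal.Quotient.mk J) with hι
  have hιJ {g : MvPolynomial (Fin 2) K} (hg : g ∈ J) : ι g = 0 := by
    simp [hι, Ideal.Quotient.eq_zero_iff_mem.2 hg]
  set φ : MvPolynomial (Fin 3) K →+* AdjoinRoot f :=
    eval₂Hom (ι.comp C) ![ι (X 0), ι (X 1), AdjoinRoot.root f] with hφ
  have hφ0 : φ (X 0) = ι (X 0) := by simp [hφ]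
  have hφ1 : φ (X 1) = ι (X 1) := by simp [hφ]
  have hφ2 : φ (X 2) = AdjoinRoot.root f := by simp [hφ]
  have hker : ∀ g ∈ Ideal.span {(X 0 : MvPolynomial (Fin 3) K) ^ d + X 1 ^ d + X 2 ^ d},
      φ g = 0 := by
    intro g hg
    obtain ⟨c, rfl⟩ := Ideal.mem_span_singleton'.1 hg
    have : ι (X 0) ^ d + ι (X 1) ^ d = AdjoinRoot.of f a := by simp [hι, ha]
    rw [map_mul, map_add, map_add, map_pow, map_pow, map_pow, hφ0, hφ1, hφ2, hroot, this,
      add_neg_cancel, mul_zero]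
  obtain ⟨s, t, hst⟩ := Ideal.mem_span_pair.1 h
  have hzero := congrArg (Ideal.Quotient.lift _ φ hker) hst
  simp only [map_add, map_mul, map_pow, Ideal.Quotient.lift_mk, hφ0, hφ1, hφ2] at hzero
  rw [← map_pow, ← map_pow, hιJ (Ideal.subset_span (by simp)), hιJ (Ideal.subset_span (by simp)),
    mul_zero, mul_zero, add_zero, pow_mul, hroot, neg_pow, ← map_pow] at hzero
  have hof : AdjoinRoot.of f (a ^ u) = 0 :=
    ((isUnit_one.neg.pow u).mul_right_eq_zero).1 hzero.symm
  have hau : a ^ u = 0 := by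
    refine AdjoinRoot.of_injective_of_monic (Polynomial.monic_X_pow_add_C a hd) ?_
      (hof.trans (map_zero _).symm)
    rw [Polynomial.degree_X_pow_add_C (Nat.pos_of_ne_zero hd)]
    exact_mod_cast Nat.pos_of_ne_zero hd
  rw [← Ideal.Quotient.eq_zero_iff_mem, map_pow]
  exact hau

/-- Let p ≥ 5 be a prime number, let K be a field of characteristic p, let b ≥ 1 and e ≥ 2
be integers, and set q = p^e and d = 2·b·p^(e−1) + 1. Let R = K[X,Y,Z]/(X^d + Y^d + Z^d)
with x, y, z the images of the variables. Then z^(b·q + p) does not belong to the ideal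
of R generated by x^(bq) and y^(bq). -/
theorem stmt_11 (p : ℕ) (hp : p.Prime) (hp5 : 5 ≤ p) (K : Type*) [Field K] [CharP K p]
    (b e q d : ℕ) (hb : 1 ≤ b) (he : 2 ≤ e) (hq : q = p ^ e)
    (hd : d = 2 * b * p ^ (e - 1) + 1)
    (x y z : MvPolynomial (Fin 3) K ⧸
      Ideal.span {(X 0 : MvPolynomial (Fin 3) K) ^ d + X 1 ^ d + X 2 ^ d})
    (hx : x = Ideal.Quotient.mk _ (X 0)) (hy : y = Ideal.Quotient.mk _ (X 1))
    (hz : z = Ideal.Quotient.mk _ (X 2)) :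
    z ^ (b * q + p) ∉ Ideal.span {x ^ (b * q), y ^ (b * q)} := by
  subst hx hy hz
  intro h
  obtain ⟨k, rfl⟩ : ∃ k, p = 2 * k + 1 := by
    obtain ⟨k, hk⟩ := hp.odd_of_ne_two (by omega)
    exact ⟨k, hk⟩
  set P := b * (2 * k + 1) ^ (e - 1) with hP
  have hn : b * q = P * (2 * k + 1) := by
    rw [hq, hP, mul_assoc, ← pow_succ, Nat.sub_add_cancel (by omega)]
  have hdP : d = 2 * P + 1 := by rw [hd, hP, mul_assoc]
  have hPp : 2 * k + 1 ≤ P :=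
    (Nat.le_self_pow (by omega) _).trans (Nat.le_mul_of_pos_left _ hb)
  have hle : b * q + (2 * k + 1) ≤ d * (k + 1) := by
    rw [hn, hdP]
    nlinarith
  refine notMem_span_X_pow_of_coeff_ne_zero
    (m := Finsupp.single 0 (d * k) + Finsupp.single 1 d) ?_ ?_
    (X_pow_add_X_pow_pow_mem_of_mk_X_pow_mem (by omega) (Ideal.mem_of_dvd _ (pow_dvd_pow _ hle) h))
  · have h0 : d * k < b * q := by
      rw [hn, hdP]
      nlinarith
    have h1 : d < b * q := by
      rw [hn, hdP]
      nlinarith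
    intro i
    fin_cases i
    · simpa using h0
    · simpa using h1
  · rw [coeff_X_pow_add_X_pow_pow (by omega), Ne, CharP.cast_eq_zero_iff K (2 * k + 1)]
    exact fun hdvd => absurd (Nat.le_of_dvd (by omega) hdvd) (by omega)
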